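/- A state-finite automaton without outputs is a Boolean-type retractable automaton if and only if it is a dilation of a semi-connected Boolean-type retractable automaton (i.e., it has a semi-connected Boolean-type retractable subautomaton of which it is a dilation). -/

import Mathlib

/-! Basic notions for state-finite automata without outputs, following M. Fuzesdi,
"Boolean-type retractable state-finite automata without outputs". -/

variable {A X : Type*}

/-- The transition function extended to words: `DeltaStar d a p = δ(a, p)`. -/
def DeltaStar (d : A → X → A) (a : A) (p : List X) : A := p.foldl d a

/-- `B` is (the state set of) a subautomaton of the automaton `(A, X, d)`. -/
def IsSubaut (d : A → X → A) (B : Set A) : Prop :=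
  B.Nonempty ∧ ∀ b ∈ B, ∀ x, d b x ∈ B

/-- `f` (restricted to `B`) is a retract homomorphism of the automaton `B`
onto its subautomaton `C`: it commutes with the transitions on `B`, maps `B` into `C`,
and leaves the elements of `C` fixed (hence is onto `C` whenever `C ⊆ B`). -/
def IsRetractHomOn (d : A → X → A) (B C : Set A) (f : A → A) : Prop :=
  (∀ a ∈ B, ∀ x, f (d a x) = d (f a) x) ∧ (∀ a ∈ B, f a ∈ C) ∧ (∀ c ∈ C, f c = c)

/-- The automaton `B` is retractable: every subautomaton of `B` is a retract
subautomaton of `B`. -/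
def RetractableOn (d : A → X → A) (B : Set A) : Prop :=
  ∀ C, C ⊆ B → IsSubaut d C → ∃ f : A → A, IsRetractHomOn d B C f

/-- The automaton `B` is a Boolean-type retractable automaton: it is retractable and there
is a family of retract homomorphisms `Λ C` of `B` onto `C`, one for each subautomaton `C`
of `B`, such that `C₁ ⊆ C₂` implies `Ker (Λ C₂) ⊆ Ker (Λ C₁)` (kernels taken on `B`). -/
def BooleanTypeOn (d : A → X → A) (B : Set A) : Prop :=
  RetractableOn d B ∧
  ∃ Λ : Set A → (A → A),
    (∀ C, C ⊆ B → IsSubaut d C → IsRetractHomOn d B C (Λ C)) ∧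
    (∀ C₁ C₂, C₁ ⊆ C₂ → C₂ ⊆ B → IsSubaut d C₁ → IsSubaut d C₂ →
      ∀ a ∈ B, ∀ b ∈ B, Λ C₂ a = Λ C₂ b → Λ C₁ a = Λ C₁ b)

/-- The Rees congruence defined by `B`. -/
def ReesRel (B : Set A) : A → A → Prop := fun a b => a = b ∨ (a ∈ B ∧ b ∈ B)

/-- The kernel of a map, as a relation. -/
def KerRel (f : A → A) : A → A → Prop := fun a b => f a = f b

/-- `r` is a congruence of the automaton `(A, X, d)`. -/
def IsCong (d : A → X → A) (r : A → A → Prop) : Prop :=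
  Equivalence r ∧ ∀ a b, r a b → ∀ x, r (d a x) (d b x)

/-- `K` is the kernel of the automaton `B`: a subautomaton of `B` contained in every
subautomaton of `B`. -/
def IsKernelOf (d : A → X → A) (B K : Set A) : Prop :=
  IsSubaut d K ∧ K ⊆ B ∧ ∀ C, C ⊆ B → IsSubaut d C → K ⊆ C

/-- The subautomata `S` and `T` (with the common transition function `d`) are isomorphic. -/
def AutIsoOn (d : A → X → A) (S T : Set A) : Prop :=
  ∃ f : A → A, Set.BijOn f S T ∧ ∀ a ∈ S, ∀ x, f (d a x) = d (f a) x

/-- `c` is a trap of the automaton with transition function `d`. -/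
def IsTrapT (d : A → X → A) (c : A) : Prop := ∀ x, d c x = c

/-- The automaton with transition function `d` is strongly connected. -/
def StronglyConnT (d : A → X → A) : Prop :=
  ∀ a b : A, ∃ p : List X, p ≠ [] ∧ DeltaStar d a p = b

/-- The automaton with transition function `d` is strongly trap connected. -/
def StronglyTrapConnT (d : A → X → A) : Prop :=
  ∃ a₀ : A, IsTrapT d a₀ ∧ (∀ c, IsTrapT d c → c = a₀) ∧
    ∀ a, a ≠ a₀ → ∀ b, ∃ p : List X, p ≠ [] ∧ DeltaStar d a p = b

/-- `R(a)`: the subautomaton generated by `a`. -/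
def Rset (d : A → X → A) (a : A) : Set A := {b | ∃ p : List X, DeltaStar d a p = b}

lemma Rset_closed (d : A → X → A) (a : A) {b : A} (hb : b ∈ Rset d a) (x : X) :
    d b x ∈ Rset d a := by
  obtain ⟨p, hp⟩ := hb
  refine ⟨p ++ [x], ?_⟩
  simp only [DeltaStar, List.foldl_append, List.foldl_cons, List.foldl_nil]
  rw [show List.foldl d a p = b from hp]

lemma Rset_mono (d : A → X → A) {a b : A} (h : b ∈ Rset d a) : Rset d b ⊆ Rset d a := by
  obtain ⟨q, hq⟩ := h
  rintro c ⟨p, hp⟩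
  refine ⟨q ++ p, ?_⟩
  simp only [DeltaStar, List.foldl_append] at *
  rw [hq, hp]

/-- `R_a`: the set of states generating the same subautomaton as `a`. -/
def Rcls (d : A → X → A) (a : A) : Set A := {b | Rset d b = Rset d a}

/-- `R[a] = R(a) \ R_a`. -/
def Rbr (d : A → X → A) (a : A) : Set A := Rset d a \ Rcls d a

lemma Rbr_closed (d : A → X → A) (a : A) {b : A} (hb : b ∈ Rbr d a) (x : X) :
    d b x ∈ Rbr d a := by
  refine ⟨Rset_closed d a hb.1 x, fun hmem => hb.2 ?_⟩
  have h1 : Rset d b ⊆ Rset d a := Rset_mono d hb.1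
  have hx : d b x ∈ Rset d b := ⟨[x], rfl⟩
  have h2 : Rset d a ⊆ Rset d b := by
    have := Rset_mono d hx
    rw [show Rset d (d b x) = Rset d a from hmem] at this
    exact this
  exact Set.Subset.antisymm h1 h2

/-- The Rees setoid on `R(a)` collapsing the subautomaton `R[a]` to a point. -/
def PFSetoid (d : A → X → A) (a : A) : Setoid ↥(Rset d a) where
  r s t := s = t ∨ (s.1 ∈ Rbr d a ∧ t.1 ∈ Rbr d a)
  iseqv := by
    refine ⟨fun s => Or.inl rfl, ?_, ?_⟩
    · rintro s t (rfl | ⟨h1, h2⟩)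
      · exact Or.inl rfl
      · exact Or.inr ⟨h2, h1⟩
    · rintro s t u (rfl | ⟨h1, h2⟩) (rfl | ⟨h3, h4⟩)
      · exact Or.inl rfl
      · exact Or.inr ⟨h3, h4⟩
      · exact Or.inr ⟨h1, h2⟩
      · exact Or.inr ⟨h1, h4⟩

/-- The state set of the principal factor `R{a} = R(a)/ρ_{R[a]}`. -/
def PFC (d : A → X → A) (a : A) : Type _ := Quotient (PFSetoid d a)

/-- The transition function of the principal factor `R{a}`. -/
def pfd (d : A → X → A) (a : A) : PFC d a → X → PFC d a := fun q x =>
  Quotient.liftOn q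
    (fun s => (Quotient.mk (PFSetoid d a) ⟨d s.1 x, Rset_closed d a s.2 x⟩ : PFC d a))
    (fun s t hst => Quotient.sound (by
      rcases hst with h | ⟨h1, h2⟩
      · exact Or.inl (by rw [h])
      · exact Or.inr ⟨Rbr_closed d a h1 x, Rbr_closed d a h2 x⟩))

/-- The automaton with transition function `d` is semi-connected: each of its
principal factors is strongly connected or strongly trap connected. -/
def SemiConnT (d : A → X → A) : Prop :=
  ∀ a : A, StronglyConnT (pfd d a) ∨ StronglyTrapConnT (pfd d a)

/-- The restriction of the transition function to a subautomaton. -/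
def restrictMap (d : A → X → A) (B : Set A) (h : ∀ b ∈ B, ∀ x, d b x ∈ B) : B → X → B :=
  fun b x => ⟨d b.1 x, h b.1 b.2 x⟩

open Classical in
/-- `A⁰`: the state set with the trap removed, in case the automaton is non-trivial
and has a unique trap; the whole state set otherwise. -/
noncomputable def ZeroPart (d : A → X → A) : Set A :=
  if Nontrivial A ∧ (∃! c : A, IsTrapT d c) then {c | ¬ IsTrapT d c} else Set.univ

lemma DeltaStar_append (d : A → X → A) (a : A) (p q : List X) :
    DeltaStar d a (p ++ q) = DeltaStar d (DeltaStar d a p) q :=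
  List.foldl_append

lemma DeltaStar_of_isTrapT {d : A → X → A} {c : A} (hc : IsTrapT d c) (p : List X) :
    DeltaStar d c p = c := by
  induction p with
  | nil => rfl
  | cons x p ih =>
    change DeltaStar d (d c x) p = c
    rw [hc x, ih]

lemma Rset_self (d : A → X → A) (a : A) : a ∈ Rset d a := ⟨[], rfl⟩

lemma isSubaut_Rset (d : A → X → A) (a : A) : IsSubaut d (Rset d a) :=
  ⟨⟨a, Rset_self d a⟩, fun _ hb x => Rset_closed d a hb x⟩

lemma DeltaStar_mem_Rset (d : A → X → A) (a : A) {b : A} (hb : b ∈ Rset d a) (p : List X) :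
    DeltaStar d b p ∈ Rset d a :=
  Rset_mono d hb ⟨p, rfl⟩

lemma DeltaStar_pfd (d : A → X → A) (a : A) (s : ↥(Rset d a)) (p : List X) :
    DeltaStar (pfd d a) (Quotient.mk (PFSetoid d a) s) p =
      Quotient.mk (PFSetoid d a) ⟨DeltaStar d s.1 p, DeltaStar_mem_Rset d a s.2 p⟩ := by
  induction p generalizing s with
  | nil => rfl
  | cons x p ih => exact ih ⟨d s.1 x, Rset_closed d a s.2 x⟩

lemma DeltaStar_restrictMap (d : A → X → A) (B : Set A) (h : ∀ b ∈ B, ∀ x, d b x ∈ B)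
    (b : ↥B) (p : List X) : (DeltaStar (restrictMap d B h) b p).1 = DeltaStar d b.1 p := by
  induction p generalizing b with
  | nil => rfl
  | cons x p ih => exact ih (restrictMap d B h b x)

/-- An automaton in which every state lies on a nontrivial cycle is semi-connected. -/
lemma semiConnT_of_forall_cycle {d : A → X → A}
    (h : ∀ a, ∃ p : List X, p ≠ [] ∧ DeltaStar d a p = a) : SemiConnT d := by
  intro a
  have reach (s t : ↥(Rset d a)) (hs : s.1 ∉ Rbr d a) : ∃ p : List X, p ≠ [] ∧
      DeltaStar (pfd d a) (Quotient.mk (PFSetoid d a) s) p = Quotient.mk (PFSetoid d a) t := by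
    have hcls : Rset d s.1 = Rset d a := by
      by_contra hne
      exact hs ⟨s.2, hne⟩
    obtain ⟨p, hp⟩ : t.1 ∈ Rset d s.1 := by rw [hcls]; exact t.2
    obtain ⟨q, hq, hqs⟩ := h s.1
    refine ⟨q ++ p, by simp [hq], ?_⟩
    rw [DeltaStar_pfd]
    congr 1
    exact Subtype.ext ((DeltaStar_append d s.1 q p).trans (by rw [hqs, hp]))
  rcases (Rbr d a).eq_empty_or_nonempty with he | ⟨e, he⟩
  · left
    intro u v
    induction u using Quotient.inductionOn with | _ s
    induction v using Quotient.inductionOn with | _ t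
    exact reach s t (by simp [he])
  · right
    have mk_eq (s : ↥(Rset d a)) (hs : s.1 ∈ Rbr d a) :
        Quotient.mk (PFSetoid d a) s = Quotient.mk (PFSetoid d a) ⟨e, he.1⟩ :=
      Quotient.sound (Or.inr ⟨hs, he⟩)
    refine ⟨Quotient.mk (PFSetoid d a) ⟨e, he.1⟩, fun x => mk_eq _ (Rbr_closed d a he x), ?_, ?_⟩
    · intro c hc
      induction c using Quotient.inductionOn with | _ s
      by_cases hs : s.1 ∈ Rbr d a
      · exact mk_eq s hs
      · obtain ⟨p, -, hp⟩ := reach s ⟨e, he.1⟩ hs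
        rw [← hp]
        exact (DeltaStar_of_isTrapT hc p).symm
    · intro u hu v
      induction u using Quotient.inductionOn with | _ s
      induction v using Quotient.inductionOn with | _ t
      exact reach s t fun hs => hu (mk_eq s hs)

lemma IsRetractHomOn.mono {d : A → X → A} {B B' C : Set A} {f : A → A}
    (h : IsRetractHomOn d B C f) (hB : B' ⊆ B) : IsRetractHomOn d B' C f :=
  ⟨fun a ha => h.1 a (hB ha), fun a ha => h.2.1 a (hB ha), h.2.2⟩

lemma BooleanTypeOn.mono {d : A → X → A} {B B' : Set A} (h : BooleanTypeOn d B)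
    (hB : B' ⊆ B) : BooleanTypeOn d B' := by
  obtain ⟨hr, Λ, h1, h2⟩ := h
  refine ⟨fun C hC hs => (hr C (hC.trans hB) hs).imp fun _ hf => hf.mono hB, Λ,
    fun C hC hs => (h1 C (hC.trans hB) hs).mono hB, fun C₁ C₂ h12 hC hs1 hs2 a ha b hb => ?_⟩
  exact h2 C₁ C₂ h12 (hC.trans hB) hs1 hs2 a (hB ha) b (hB hb)

/-- In a retractable automaton every state that is a value of the transition function lies on
a nontrivial cycle. -/
lemma RetractableOn.exists_cycle {d : A → X → A} (h : RetractableOn d Set.univ) (a : A) (x : X) :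
    ∃ p : List X, p ≠ [] ∧ DeltaStar d (d a x) p = d a x := by
  obtain ⟨f, hf, hfR, hfix⟩ := h _ (Set.subset_univ _) (isSubaut_Rset d (d a x))
  obtain ⟨p, hp⟩ := hfR a trivial
  refine ⟨p ++ [x], by simp, ?_⟩
  rw [DeltaStar_append, hp]
  change d (f a) x = d a x
  rw [← hf a trivial x, hfix _ (Rset_self d _)]

/-- A dilation of a Boolean-type retractable automaton is Boolean-type retractable. -/
lemma BooleanTypeOn.of_dilation [Nonempty X] {d : A → X → A} {B : Set A} (hB : IsSubaut d B)
    {φ : A → A} (hφB : ∀ a, φ a ∈ B) (hφ : ∀ b ∈ B, φ b = b) (hd : ∀ a x, d a x = d (φ a) x)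
    (h : BooleanTypeOn d B) : BooleanTypeOn d Set.univ := by
  classical
  obtain ⟨-, Λ, hΛ, hker⟩ := h
  have hdB (a : A) (x : X) : d a x ∈ B := hd a x ▸ hB.2 _ (hφB a) x
  have hsub {C : Set A} (hC : IsSubaut d C) : IsSubaut d (C ∩ B) := by
    obtain ⟨c, hc⟩ := hC.1
    obtain ⟨x⟩ := ‹Nonempty X›
    exact ⟨⟨d c x, hC.2 c hc x, hdB c x⟩, fun b hb y => ⟨hC.2 b hb.1 y, hB.2 b hb.2 y⟩⟩
  have hret {C : Set A} (hC : IsSubaut d C) : IsRetractHomOn d B (C ∩ B) (Λ (C ∩ B)) :=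
    hΛ _ Set.inter_subset_right (hsub hC)
  let M (C : Set A) (a : A) : A := if a ∈ C then a else Λ (C ∩ B) (φ a)
  have hMB {C : Set A} (hC : IsSubaut d C) {b : A} (hb : b ∈ B) : M C b = Λ (C ∩ B) b := by
    by_cases hbC : b ∈ C
    · simp only [M, if_pos hbC, (hret hC).2.2 b ⟨hbC, hb⟩]
    · simp only [M, if_neg hbC, hφ b hb]
  have hM {C : Set A} (hC : IsSubaut d C) : IsRetractHomOn d Set.univ C (M C) := by
    refine ⟨fun a _ x => ?_, fun a _ => ?_, fun c hc => if_pos hc⟩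
    · by_cases ha : a ∈ C
      · simp only [M, if_pos ha, if_pos (hC.2 a ha x)]
      · rw [hMB hC (hdB a x), hd a x, (hret hC).1 _ (hφB a) x]
        simp only [M, if_neg ha]
    · by_cases ha : a ∈ C
      · simpa only [M, if_pos ha] using ha
      · simpa only [M, if_neg ha] using ((hret hC).2.1 _ (hφB a)).1
  refine ⟨fun C _ hC => ⟨M C, hM hC⟩, M, fun C _ hC => hM hC, ?_⟩
  intro C₁ C₂ h12 _ hC₁ hC₂
  have key {u v : A} (hu : u ∈ B) (hv : v ∈ B) (huv : Λ (C₂ ∩ B) u = Λ (C₂ ∩ B) v) :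
      Λ (C₁ ∩ B) u = Λ (C₁ ∩ B) v :=
    hker _ _ (Set.inter_subset_inter_left B h12) Set.inter_subset_right (hsub hC₁) (hsub hC₂)
      u hu v hv huv
  have mixed {a b : A} (ha : a ∈ C₂) (hb : b ∉ C₂) (hab : M C₂ a = M C₂ b) :
      M C₁ a = M C₁ b := by
    have hab' : a = Λ (C₂ ∩ B) (φ b) := by simpa only [M, if_pos ha, if_neg hb] using hab
    have haB : a ∈ B := hab' ▸ ((hret hC₂).2.1 _ (hφB b)).2
    rw [hMB hC₁ haB, key haB (hφB b) (by rw [(hret hC₂).2.2 a ⟨ha, haB⟩, ← hab'])]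
    simp only [M, if_neg fun hb' => hb (h12 hb')]
  intro a _ b _ hab
  by_cases ha : a ∈ C₂ <;> by_cases hb : b ∈ C₂
  · have : a = b := by simpa only [M, if_pos ha, if_pos hb] using hab
    rw [this]
  · exact mixed ha hb hab
  · exact (mixed hb ha hab.symm).symm
  · simp only [M, if_neg ha, if_neg hb] at hab
    simp only [M, if_neg fun ha' => ha (h12 ha'), if_neg fun hb' => hb (h12 hb')]
    exact key (hφB a) (hφB b) hab

/-- A state-finite automaton is a Boolean-type retractable automaton iff
it is a dilation of a semi-connected Boolean-type retractable automaton, i.e. it has a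
semi-connected Boolean-type retractable subautomaton of which it is a dilation. -/
theorem booleanType_iff_dilation_of_semiconnected [Finite A] [Nonempty A] [Nonempty X]
    (δ : A → X → A) :
    BooleanTypeOn δ Set.univ ↔
      ∃ (B : Set A) (hB : IsSubaut δ B),
        (∃ φ : A → A, (∀ a, φ a ∈ B) ∧ (∀ b ∈ B, φ b = b) ∧ ∀ a x, δ a x = δ (φ a) x) ∧
        BooleanTypeOn δ B ∧ SemiConnT (restrictMap δ B hB.2) := by
  constructor
  · intro h
    have hB : IsSubaut δ {b | ∃ a x, δ a x = b} :=
      ⟨⟨δ (Classical.arbitrary A) (Classical.arbitrary X), _, _, rfl⟩, fun b _ x => ⟨b, x, rfl⟩⟩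
    refine ⟨_, hB, ?_, h.mono (Set.subset_univ _), semiConnT_of_forall_cycle ?_⟩
    · obtain ⟨φ, h1, h2, h3⟩ := h.1 _ (Set.subset_univ _) hB
      refine ⟨φ, fun a => h2 a trivial, h3, fun a x => ?_⟩
      rw [← h1 a trivial x, h3 _ ⟨a, x, rfl⟩]
    · rintro ⟨_, a, x, rfl⟩
      obtain ⟨p, hp, hpa⟩ := h.1.exists_cycle a x
      exact ⟨p, hp, Subtype.ext ((DeltaStar_restrictMap _ _ _ _ _).trans hpa)⟩
  · rintro ⟨B, hB, ⟨φ, hφB, hφ, hd⟩, hbool, -⟩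
    exact hbool.of_dilation hB hφB hφ hd
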